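/- arXiv:2211.01986 — 3 statements merged into one kernel-verified Lean document; each statement's English description precedes it below -/
import Mathlib

section
/- Let σ > 0, r ≥ max{σ, 2}, and b₁, b₂ ∈ (0,1] with 1 - σ/r ≤ b₂/b₁ ≤ 1. Then ((b₁^r + b₂^r)/2)^(1/r) ≥ (b₁+b₂)/2 + (r-1)·(1 - e^(-σ/2))/(4σ)·|b₁ - b₂|². -/
open Real

lemma aux_two_mul_le (v : ℝ) (h0 : 0 ≤ v) (h1 : v < 1) : 2 * v ≤ log ((1 + v) / (1 - v)) := by
  have h1' : 0 < 1 - v := by linarith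
  have h := Real.le_log_one_add_of_nonneg (x := 2 * v / (1 - v)) (by positivity)
  have e1 : 2 * (2 * v / (1 - v)) / (2 * v / (1 - v) + 2) = 2 * v := by
    have : 2 * v / (1 - v) + 2 = 2 / (1 - v) := by field_simp; ring
    rw [this]; field_simp; try ring
  have e2 : 1 + 2 * v / (1 - v) = (1 + v) / (1 - v) := by field_simp; ring
  rwa [e1, e2] at h

lemma aux_h (s : ℝ) (hs : 0 < s) : (1 - exp (-s / 2)) / s ≤ 1 / (2 + s / 2) := by
  have key : (2 - s / 2) / (2 + s / 2) ≤ exp (-s / 2) := by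
    rcases le_or_gt 4 s with h | h
    · exact (div_nonpos_of_nonpos_of_nonneg (by linarith) (by linarith)).trans (exp_pos _).le
    · have h2 := aux_two_mul_le (s / 4) (by linarith) (by linarith)
      rw [Real.le_log_iff_exp_le (div_pos (by linarith) (by linarith))] at h2
      have e : exp (-s / 2) = (exp (2 * (s / 4)))⁻¹ := by rw [← exp_neg]; congr 1; ring
      rw [e]
      have h3 := inv_anti₀ (exp_pos _) h2
      refine le_trans (le_of_eq ?_) h3
      rw [inv_div, div_eq_div_iff (by linarith) (by linarith)]; ring
  rw [div_le_iff₀ (by linarith)] at key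
  rw [div_le_div_iff₀ hs (by linarith)]
  nlinarith

lemma aux_B (r v : ℝ) (hr : 2 ≤ r) (h0 : 0 ≤ v) (h1 : v ≤ 1) (hu : 1.6 ≤ r * v) :
    (r - 1) * v / 2 ≤ log (((1 + v) ^ r + (1 - v) ^ r) / 2) := by
  have hP : 0 < (1 + v) ^ r := rpow_pos_of_pos (by linarith) _
  have hQ : 0 ≤ (1 - v) ^ r := rpow_nonneg (by linarith) _
  have h2 : log ((1 + v) ^ r / 2) ≤ log (((1 + v) ^ r + (1 - v) ^ r) / 2) :=
    log_le_log (by positivity) (by linarith)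
  refine le_trans ?_ h2
  rw [log_div hP.ne' (by norm_num), log_rpow (by linarith)]
  have h3 := Real.le_log_one_add_of_nonneg h0
  have h4 := Real.log_two_lt_d9
  have h5 : r * (2 * v / (v + 2)) ≤ r * log (1 + v) := mul_le_mul_of_nonneg_left h3 (by linarith)
  have h6 : (r - 1) * v / 2 + 0.7 ≤ r * (2 * v / (v + 2)) := by
    rw [← mul_div_assoc, le_div_iff₀ (by linarith)]
    nlinarith [mul_nonneg (sub_nonneg.2 hu) (sub_nonneg.2 (h1.trans (by norm_num : (1:ℝ) ≤ 2))), sq_nonneg (v - 0.4)]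
  linarith

lemma aux_deriv (r v : ℝ) (hr : 2 ≤ r) (h0 : 0 < v) (hu : r * v ≤ 1.6) :
    (r - 1) * ((r * (2 * v) * (2 + 2 * v + r * v) - r * v ^ 2 * (2 + r)) / (2 + 2 * v + r * v) ^ 2) ≤
     (r * (1 + v) ^ (r - 1) - r * (1 - v) ^ (r - 1)) / ((1 + v) ^ r + (1 - v) ^ r) := by
  have hv : v ≤ 0.8 := by nlinarith
  have hm : 0 < 1 - v := by linarith
  have hp : 0 < 1 + v := by linarith
  rw [rpow_sub_one hp.ne', rpow_sub_one hm.ne']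
  have hPQ1 : (1 - v) ^ r * (1 + r * (2 * v / (1 - v))) ≤ (1 + v) ^ r := by
    have h := one_add_mul_self_le_rpow_one_add (s := 2 * v / (1 - v)) (p := r)
      (by linarith [show 0 ≤ 2 * v / (1 - v) by positivity]) (by linarith)
    have e2 : 1 + 2 * v / (1 - v) = (1 + v) / (1 - v) := by field_simp; ring
    rw [e2, div_rpow hp.le hm.le, le_div_iff₀ (rpow_pos_of_pos hm _)] at h
    linarith
  have hPQ2 : (1 - v) ^ r * (1 + 2 * (r * v) + 2 * (r * v) ^ 2) ≤ (1 + v) ^ r := by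
    have h := aux_two_mul_le v h0.le (by linarith)
    have h2 : 2 * (r * v) ≤ log (((1 + v) / (1 - v)) ^ r) := by
      rw [log_rpow (by positivity)]; nlinarith
    rw [Real.le_log_iff_exp_le (by positivity), div_rpow hp.le hm.le,
      le_div_iff₀ (rpow_pos_of_pos hm _)] at h2
    have h3 := Real.quadratic_le_exp_of_nonneg (x := 2 * (r * v)) (by positivity)
    have h4 : (0:ℝ) < (1 - v) ^ r := rpow_pos_of_pos hm _
    nlinarith
  have hQ : (0:ℝ) < (1 - v) ^ r := rpow_pos_of_pos hm _
  have hP : (0:ℝ) < (1 + v) ^ r := rpow_pos_of_pos hp _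
  generalize (1 - v) ^ r = Q at *
  generalize (1 + v) ^ r = P at *
  have s1 : (r - 1) * ((P - Q) / (1 + v)) ≤ r * (P / (1 + v)) - r * (Q / (1 - v)) := by
    have : r * (P / (1 + v)) - r * (Q / (1 - v)) - (r - 1) * ((P - Q) / (1 + v))
      = (P - Q * (1 + r * (2 * v / (1 - v)))) / (1 + v) := by field_simp; ring
    have h : 0 ≤ (P - Q * (1 + r * (2 * v / (1 - v)))) / (1 + v) := div_nonneg (by linarith) hp.le
    linarith
  obtain ⟨u, hu'⟩ : ∃ u, u = r * v := ⟨_, rfl⟩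
  have hu2 : 2 * v ≤ u := by nlinarith
  have hu0 : 0 < u := by linarith
  rw [← hu'] at hPQ2 hu
  have s2 : (u + u ^ 2) / (1 + u + u ^ 2) ≤ (P - Q) / (P + Q) := by
    rw [div_le_div_iff₀ (by positivity) (by positivity)]; nlinarith
  have s3 : (r * (2 * v) * (2 + 2 * v + r * v) - r * v ^ 2 * (2 + r)) / (2 + 2 * v + r * v) ^ 2
      ≤ (u + u ^ 2) / (1 + u + u ^ 2) / (1 + v) := by
    have e : r * (2 * v) * (2 + 2 * v + r * v) - r * v ^ 2 * (2 + r)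
      = u * (4 + 2 * v + u) := by rw [hu']; ring
    rw [e, ← hu', div_div, div_le_div_iff₀ (by positivity) (by positivity)]
    have hk : (4 + 2 * v + u) * ((1 + u + u ^ 2) * (1 + v)) ≤ (1 + u) * (2 + 2 * v + u) ^ 2 := by
      have c2 : 0 ≤ 2 + 2 * u - 2 * u ^ 2 := by nlinarith
      have c3 : 0 ≤ 3 * u + (2 + 5 * u - 3 * u ^ 2 - u ^ 3) * v := by
        have k1 : 0 ≤ u * v * (4.8 + 1.6 ^ 2 - 3 * u - u ^ 2) :=
          mul_nonneg (by positivity) (by nlinarith)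
        have k2 : u * v ≤ u * 0.8 := mul_le_mul_of_nonneg_left hv hu0.le
        nlinarith
      nlinarith [mul_nonneg c2 (sq_nonneg v)]
    nlinarith
  calc _ ≤ (r - 1) * ((u + u ^ 2) / (1 + u + u ^ 2) / (1 + v)) :=
        mul_le_mul_of_nonneg_left s3 (by linarith)
    _ ≤ (r - 1) * ((P - Q) / (P + Q) / (1 + v)) := by
        have : 0 ≤ r - 1 := by linarith
        gcongr
    _ = (r - 1) * ((P - Q) / (1 + v)) / (P + Q) := by field_simp
    _ ≤ _ := by
        refine div_le_div_of_nonneg_right ?_ (by positivity)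
        exact s1

lemma aux_A (r v : ℝ) (hr : 2 ≤ r) (h0 : 0 ≤ v) (hu : r * v ≤ 1.6) :
    (r - 1) * (r * v ^ 2 / (2 + 2 * v + r * v)) ≤ log (((1 + v) ^ r + (1 - v) ^ r) / 2) := by
  have hpos : ∀ x ∈ Set.Icc 0 v, 0 < 1 - x ∧ 0 < 1 + x ∧ 0 ≤ x ∧ r * x ≤ 1.6 := by
    intro x hx
    have : r * x ≤ 1.6 := le_trans (mul_le_mul_of_nonneg_left hx.2 (by linarith)) hu
    have : x ≤ 0.8 := by nlinarith [hx.1]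
    exact ⟨by linarith, by linarith [hx.1], hx.1, by assumption⟩
  have hd : ∀ x ∈ Set.Icc 0 v, HasDerivAt
      (fun x => log ((1 + x) ^ r + (1 - x) ^ r) - (r - 1) * (r * x ^ 2 / (2 + 2 * x + r * x)))
      ((r * (1 + x) ^ (r - 1) - r * (1 - x) ^ (r - 1)) / ((1 + x) ^ r + (1 - x) ^ r) -
       (r - 1) * ((r * (2 * x) * (2 + 2 * x + r * x) - r * x ^ 2 * (2 + r)) / (2 + 2 * x + r * x) ^ 2)) x := by
    intro x hx
    obtain ⟨a1, a2, a3, a4⟩ := hpos x hx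
    have d1 : HasDerivAt (fun x : ℝ => (1 + x) ^ r) (r * (1 + x) ^ (r - 1)) x := by
      have := ((hasDerivAt_id x).const_add 1).rpow_const (p := r) (Or.inl a2.ne')
      exact this.congr_deriv (by simp)
    have d2 : HasDerivAt (fun x : ℝ => (1 - x) ^ r) (-(r * (1 - x) ^ (r - 1))) x := by
      have := ((hasDerivAt_id x).const_sub 1).rpow_const (p := r) (Or.inl a1.ne')
      exact this.congr_deriv (by simp)
    have d3 : HasDerivAt (fun x : ℝ => r * x ^ 2) (r * (2 * x)) x := by
      have := (hasDerivAt_pow 2 x).const_mul r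
      exact this.congr_deriv (by simp)
    have d4 : HasDerivAt (fun x : ℝ => 2 + 2 * x + r * x) (2 + r) x := by
      have := (((hasDerivAt_id x).const_mul 2).const_add 2).add ((hasDerivAt_id x).const_mul r)
      exact this.congr_deriv (by simp)
    have hne : 2 + 2 * x + r * x ≠ 0 := by positivity
    have d5 := ((d1.add d2).log (by simp only [Pi.add_apply]; positivity)).sub ((d3.div d4 hne).const_mul (r - 1))
    exact d5.congr_deriv (by simp [sub_eq_add_neg])
  have mono := monotoneOn_of_deriv_nonneg (convex_Icc 0 v)
    (fun x hx => (hd x hx).continuousAt.continuousWithinAt)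
    (fun x hx => (hd x (interior_subset hx)).differentiableAt.differentiableWithinAt)
    (fun x hx => by
      rw [(hd x (interior_subset hx)).deriv]
      rw [interior_Icc] at hx
      have := aux_deriv r x hr hx.1 (hpos x ⟨hx.1.le, hx.2.le⟩).2.2.2
      linarith)
  have h := mono (Set.left_mem_Icc.2 h0) (Set.right_mem_Icc.2 h0) h0
  obtain ⟨a1, a2, a3, a4⟩ := hpos v (Set.right_mem_Icc.2 h0)
  rw [log_div (by positivity) (by norm_num)]
  norm_num at h
  linarith

theorem power_mean_deficit (σ r b₁ b₂ : ℝ) (hσ : 0 < σ) (hr : max σ 2 ≤ r)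
    (hb₁ : b₁ ∈ Set.Ioc (0:ℝ) 1) (hb₂ : b₂ ∈ Set.Ioc (0:ℝ) 1)
    (hratio₁ : 1 - σ / r ≤ b₂ / b₁) (hratio₂ : b₂ / b₁ ≤ 1) :
    ((b₁ ^ r + b₂ ^ r) / 2) ^ (1 / r) ≥
      (b₁ + b₂) / 2 + (r - 1) * (1 - Real.exp (-σ / 2)) / (4 * σ) * |b₁ - b₂| ^ 2 := by
  have hr2 : 2 ≤ r := le_trans (le_max_right _ _) hr
  obtain ⟨p1, q1⟩ := hb₁
  obtain ⟨p2, q2⟩ := hb₂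
  rw [div_le_one p1] at hratio₂
  have hr0 : 0 < r := by linarith
  obtain ⟨a, ha⟩ : ∃ a, a = (b₁ + b₂) / 2 := ⟨_, rfl⟩
  have ha0 : 0 < a := by linarith
  obtain ⟨v, hv⟩ : ∃ v, v = (b₁ - b₂) / 2 / a := ⟨_, rfl⟩
  have hv0 : 0 ≤ v := by rw [hv]; exact div_nonneg (by linarith) ha0.le
  have hav : a * v = (b₁ - b₂) / 2 := by rw [hv]; field_simp
  have e1 : b₁ = a * (1 + v) := by linarith
  have e2 : b₂ = a * (1 - v) := by linarith
  have hv1 : 0 < 1 - v := by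
    rw [e2] at p2; exact pos_of_mul_pos_right p2 ha0.le
  have hs : 2 * r * v ≤ σ * (1 + v) := by
    rw [e1, e2, mul_div_mul_left _ _ ha0.ne', le_div_iff₀ (by linarith)] at hratio₁
    have : r * ((1 - σ / r) * (1 + v)) ≤ r * (1 - v) := mul_le_mul_of_nonneg_left hratio₁ hr0.le
    have e : r * ((1 - σ / r) * (1 + v)) = (r - σ) * (1 + v) := by field_simp
    nlinarith
  obtain ⟨h, hh⟩ : ∃ h, h = (1 - exp (-σ / 2)) / σ := ⟨_, rfl⟩
  have hh1 : h ≤ 1 / (2 + σ / 2) := hh ▸ aux_h σ hσ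
  have hh2 : h ≤ 1 / σ := by
    rw [hh]; gcongr; linarith [exp_pos (-σ / 2)]
  have hh0 : 0 ≤ h := by
    rw [hh]; refine div_nonneg ?_ hσ.le
    have : exp (-σ / 2) ≤ 1 := exp_le_one_iff.2 (by linarith)
    linarith
  have hL : r * (r - 1) * h * a * v ^ 2 ≤ log (((1 + v) ^ r + (1 - v) ^ r) / 2) := by
    have hA : r * (r - 1) * h * a * v ^ 2 ≤ (r - 1) * (r * v ^ 2) * (h / (1 + v)) := by
      have : a ≤ 1 / (1 + v) := by rw [le_div_iff₀ (by linarith)]; linarith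
      have h3 : 0 ≤ r - 1 := by linarith
      have h4 : 0 ≤ (r - 1) * (r * v ^ 2) * h := by positivity
      calc _ = (r - 1) * (r * v ^ 2) * h * a := by ring
        _ ≤ (r - 1) * (r * v ^ 2) * h * (1 / (1 + v)) := mul_le_mul_of_nonneg_left this h4
        _ = _ := by ring
    refine hA.trans ?_
    have h3 : 0 ≤ r - 1 := by linarith
    rcases le_total (r * v) 1.6 with hu | hu
    · refine le_trans ?_ (aux_A r v hr2 hv0 hu)
      rw [mul_assoc]
      refine mul_le_mul_of_nonneg_left ?_ h3
      rw [div_eq_mul_one_div (r * v ^ 2) (2 + 2 * v + r * v)]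
      refine mul_le_mul_of_nonneg_left ?_ (by positivity)
      rw [le_div_iff₀ (by positivity)] at hh1
      rw [div_le_div_iff₀ (by linarith) (by positivity)]
      nlinarith
    · refine le_trans ?_ (aux_B r v hr2 hv0 (by linarith) hu)
      have hvp : 0 < v := by
        rcases hv0.eq_or_lt with h | h
        · rw [← h] at hu; norm_num at hu
        · exact h
      rw [le_div_iff₀ hσ] at hh2
      have : h / (1 + v) ≤ 1 / (2 * r * v) := by
        rw [div_le_div_iff₀ (by linarith) (by positivity)]
        nlinarith
      calc _ ≤ (r - 1) * (r * v ^ 2) * (1 / (2 * r * v)) :=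
            mul_le_mul_of_nonneg_left this (by positivity)
        _ = _ := by field_simp
  have hM : (b₁ ^ r + b₂ ^ r) / 2 = a ^ r * (((1 + v) ^ r + (1 - v) ^ r) / 2) := by
    rw [e1, e2, mul_rpow ha0.le (by linarith), mul_rpow ha0.le hv1.le]; ring
  have hX : 0 < ((1 + v) ^ r + (1 - v) ^ r) / 2 := by positivity
  rw [hM, mul_rpow (by positivity) hX.le, ← rpow_mul ha0.le, mul_one_div_cancel hr0.ne', rpow_one,
    rpow_def_of_pos hX, sq_abs, ← ha]
  have h5 := add_one_le_exp (log (((1 + v) ^ r + (1 - v) ^ r) / 2) * (1 / r))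
  have h6 : (r - 1) * h * a * v ^ 2 ≤ log (((1 + v) ^ r + (1 - v) ^ r) / 2) * (1 / r) := by
    rw [mul_one_div, le_div_iff₀ hr0]; linarith
  have h7 : a * (1 + (r - 1) * h * a * v ^ 2) ≤
      a * exp (log (((1 + v) ^ r + (1 - v) ^ r) / 2) * (1 / r)) :=
    mul_le_mul_of_nonneg_left (by linarith) ha0.le
  refine ge_iff_le.2 (le_trans (le_of_eq ?_) h7)
  have e3 : b₁ - b₂ = 2 * (a * v) := by linarith
  rw [e3, hh]; field_simp; ring
end

section
/- Let c ≥ 1 and p > 4√2·c be real numbers. If 0 < a₂ ≤ a₁ satisfy (a₁^p + a₂^p)^(1/p) ≤ 2^(1/p - 1/2) and |aᵢ - 1/√2| ≤ c/p for i = 1, 2, then |a₁ - a₂| ≤ 3.65·√(c/(p-2))·√(1 - a₁² - a₂²). -/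
open Real

lemma key_bound (c p x : ℝ) (hc : 1 ≤ c) (hp : 5.6 * c ≤ p) (hx : |x - 1| * p ≤ 3 / 2 * c) :
    1 + p / 2 * (x ^ 2 - 1) + p * (p - 2) / (13.3225 * c) * (x - 1) ^ 2 ≤ x ^ p := by
  have hp0 : 0 < p := by linarith
  have hc0 : 0 < c := by linarith
  have hab : |x - 1| ≤ 0.27 := by
    by_contra h
    push Not at h
    nlinarith
  obtain ⟨hl, hu⟩ := abs_le.1 hab
  have hx0 : 0 < x := by linarith
  by_cases hA : 0 ≤ 1 + p / 4 * (x ^ 2 - 1)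
  · have hb := one_add_mul_self_le_rpow_one_add (s := x ^ 2 - 1) (by nlinarith) (p := p / 4) (by linarith)
    have e : x ^ p = ((1 + (x ^ 2 - 1)) ^ (p / 4)) ^ 2 := by
      rw [show 1 + (x ^ 2 - 1) = x ^ (2:ℝ) by rw [Real.rpow_two]; ring, ← Real.rpow_mul hx0.le,
        ← Real.rpow_two, ← Real.rpow_mul hx0.le]
      congr 1; ring
    have h2 : (1 + p / 4 * (x ^ 2 - 1)) ^ 2 ≤ x ^ p := by
      rw [e]; exact pow_le_pow_left₀ hA hb 2
    have h3 : p * (p - 2) / (13.3225 * c) ≤ p ^ 2 / 13 := by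
      rw [div_le_div_iff₀ (by positivity) (by positivity)]
      nlinarith [mul_nonneg (sq_nonneg p) (sub_nonneg.2 hc)]
    have h4 : p * (p - 2) / (13.3225 * c) * (x - 1) ^ 2 ≤ p ^ 2 / 13 * (x - 1) ^ 2 := by gcongr
    have h5 : (2.9:ℝ) ≤ (x + 1) ^ 2 := by nlinarith
    have h6 := mul_le_mul_of_nonneg_left h5 (mul_nonneg (sq_nonneg p) (sq_nonneg (x - 1)))
    have h7 : 0 ≤ p ^ 2 * (x - 1) ^ 2 := by positivity
    nlinarith
  · push Not at hA
    have hx1 : x < 1 := by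
      by_contra h
      push Not at h
      have : 0 ≤ p / 4 * (x ^ 2 - 1) := mul_nonneg (by linarith) (by nlinarith)
      linarith
    rw [abs_of_neg (by linarith)] at hx
    have hpos : 0 < x ^ p := Real.rpow_pos_of_pos hx0 p
    have h1 : p * (p - 2) / (13.3225 * c) * (x - 1) ^ 2 ≤ p * (1 - x) * (3 / 2) / 13.3225 := by
      rw [div_mul_eq_mul_div, div_le_div_iff₀ (by positivity) (by positivity)]
      have : (1 - x) * p * (p * (1 - x)) ≤ 3 / 2 * c * (p * (1 - x)) :=
        mul_le_mul_of_nonneg_right (by linarith) (mul_nonneg hp0.le (by linarith))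
      nlinarith [mul_nonneg hp0.le (sq_nonneg (x - 1))]
    have h2 : p * (1 - x) * 1.73 ≤ p * (1 - x) * (1 + x) :=
      mul_le_mul_of_nonneg_left (by linarith) (mul_nonneg hp0.le (by linarith))
    have h3 : p * (1 - x) * (1 + x) = p * (1 - x ^ 2) := by ring
    have h4 : p / 2 * (x ^ 2 - 1) = - (p * (1 - x ^ 2)) / 2 := by ring
    have h5 : p / 4 * (x ^ 2 - 1) = - (p * (1 - x ^ 2)) / 4 := by ring
    rw [h3] at h2
    rw [h5] at hA
    rw [h4]
    generalize p * (p - 2) / (13.3225 * c) * (x - 1) ^ 2 = T at *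
    generalize p * (1 - x ^ 2) = B at *
    generalize p * (1 - x) = A at *
    norm_num at h1 h2
    linarith

theorem a1_minus_a2_bound (c p a₁ a₂ : ℝ) (hc : 1 ≤ c) (hp : 4 * Real.sqrt 2 * c < p)
    (ha₂ : 0 < a₂) (ha₁₂ : a₂ ≤ a₁)
    (hnorm : (a₁ ^ p + a₂ ^ p) ^ (1 / p) ≤ (2:ℝ) ^ (1 / p - 1 / 2))
    (h₁ : |a₁ - 1 / Real.sqrt 2| ≤ c / p) (h₂ : |a₂ - 1 / Real.sqrt 2| ≤ c / p) :
    |a₁ - a₂| ≤ 3.65 * Real.sqrt (c / (p - 2)) * Real.sqrt (1 - a₁ ^ 2 - a₂ ^ 2) := by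
  have hs0 : 0 < Real.sqrt 2 := by positivity
  have hsq : Real.sqrt 2 ^ 2 = 2 := Real.sq_sqrt (by norm_num)
  have hs1 : 1.4 ≤ Real.sqrt 2 := Real.le_sqrt_of_sq_le (by norm_num)
  have hs2 : Real.sqrt 2 ≤ 3 / 2 := by nlinarith
  have hp' : 5.6 * c ≤ p := by nlinarith
  have hp0 : 0 < p := by linarith
  have hp2 : 0 < p - 2 := by linarith
  have hc0 : 0 < c := by linarith
  have ha₁ : 0 < a₁ := by linarith
  have conv : ∀ a : ℝ, |a - 1 / Real.sqrt 2| ≤ c / p → |Real.sqrt 2 * a - 1| * p ≤ 3 / 2 * c := by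
    intro a h
    have e : Real.sqrt 2 * a - 1 = Real.sqrt 2 * (a - 1 / Real.sqrt 2) := by field_simp
    rw [e, abs_mul, abs_of_pos hs0]
    rw [le_div_iff₀ hp0] at h
    have := abs_nonneg (a - 1 / Real.sqrt 2)
    calc _ = Real.sqrt 2 * (|a - 1 / Real.sqrt 2| * p) := by ring
      _ ≤ 3 / 2 * c := by gcongr
  have k1 := key_bound c p _ hc hp' (conv a₁ h₁)
  have k2 := key_bound c p _ hc hp' (conv a₂ h₂)
  have hsum : (Real.sqrt 2 * a₁) ^ p + (Real.sqrt 2 * a₂) ^ p ≤ 2 := by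
    have hS : 0 ≤ a₁ ^ p + a₂ ^ p := by positivity
    have h := Real.rpow_le_rpow (by positivity) hnorm hp0.le
    rw [← Real.rpow_mul hS, ← Real.rpow_mul (by norm_num), one_div_mul_cancel hp0.ne',
      Real.rpow_one] at h
    rw [Real.mul_rpow hs0.le ha₁.le, Real.mul_rpow hs0.le ha₂.le, ← mul_add]
    calc _ ≤ Real.sqrt 2 ^ p * 2 ^ ((1 / p - 1 / 2) * p) := by gcongr
      _ = 2 := by
        rw [Real.sqrt_eq_rpow, ← Real.rpow_mul (by norm_num), ← Real.rpow_add (by norm_num)]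
        rw [show 1 / 2 * p + (1 / p - 1 / 2) * p = 1 by field_simp; ring, Real.rpow_one]
  set K := p * (p - 2) / (13.3225 * c) with hK
  have hK0 : 0 < K := by positivity
  have hsub : K * (a₁ - a₂) ^ 2 ≤ p * (1 - a₁ ^ 2 - a₂ ^ 2) := by
    have e1 : (Real.sqrt 2 * a₁) ^ 2 = 2 * a₁ ^ 2 := by rw [mul_pow, hsq]
    have e2 : (Real.sqrt 2 * a₂) ^ 2 = 2 * a₂ ^ 2 := by rw [mul_pow, hsq]
    have e3 : 2 * (a₁ - a₂) ^ 2 ≤ 2 * ((Real.sqrt 2 * a₁ - 1) ^ 2 + (Real.sqrt 2 * a₂ - 1) ^ 2) := by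
      have : 2 * (a₁ - a₂) ^ 2 = ((Real.sqrt 2 * a₁ - 1) - (Real.sqrt 2 * a₂ - 1)) ^ 2 := by
        linear_combination (-(a₁ - a₂) ^ 2) * hsq
      rw [this]
      nlinarith [sq_nonneg ((Real.sqrt 2 * a₁ - 1) + (Real.sqrt 2 * a₂ - 1))]
    have e4 := mul_le_mul_of_nonneg_left e3 hK0.le
    rw [e1] at k1
    rw [e2] at k2
    linarith
  have hfin : (a₁ - a₂) ^ 2 ≤ 3.65 ^ 2 * (c / (p - 2) * (1 - a₁ ^ 2 - a₂ ^ 2)) := by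
    have : K * (3.65 ^ 2 * (c / (p - 2) * (1 - a₁ ^ 2 - a₂ ^ 2))) = p * (1 - a₁ ^ 2 - a₂ ^ 2) := by
      rw [hK]; field_simp; norm_num
    rw [← this] at hsub
    exact le_of_mul_le_mul_left hsub hK0
  have h := Real.abs_le_sqrt hfin
  rwa [Real.sqrt_mul (by positivity), Real.sqrt_sq (by norm_num), Real.sqrt_mul (by positivity),
    ← mul_assoc] at h
end

section
/- For every real p > 5, if R is a positive random variable with density g_p(x) = Γ(1+1/p)^(-1)·p·x^p·e^(-x^p) on (0,∞), then E|R - 1|² ≤ 2/(Γ(1+1/p)·p²). -/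
open Real MeasureTheory
lemma exp_bd (y : ℝ) : (exp y - 1)^2 ≤ y^2 * (exp y ^2 + 1)/2 := by
  have key : ∀ z : ℝ, 0 ≤ z → 2*(exp z - 1) ≤ z * (exp z + 1) := by
    intro z hz
    have hm : MonotoneOn (fun z : ℝ => z * (exp z + 1) - 2*(exp z - 1)) (Set.Ici 0) := by
      apply monotoneOn_of_hasDerivWithinAt_nonneg (f' := fun z => (1 * (exp z + 1) + z * exp z) - 2 * exp z) (convex_Ici 0)
      · fun_prop
      · intro x hx
        apply HasDerivAt.hasDerivWithinAt
        exact ((hasDerivAt_id x).mul ((Real.hasDerivAt_exp x).add_const 1)).sub (((Real.hasDerivAt_exp x).sub_const 1).const_mul 2)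
      · intro x hx
        have h1 := Real.add_one_le_exp (-x)
        have h2 : exp (-x) * exp x = 1 := by rw [← Real.exp_add]; simp
        nlinarith [Real.exp_pos x]
    have := hm (Set.mem_Ici.2 le_rfl) (Set.mem_Ici.2 hz) hz
    simp at this
    linarith
  have k2 : 4 * (exp y - 1)^2 ≤ y^2 * (exp y + 1)^2 := by
    rcases le_total 0 y with h | h
    · have h1 := key y h
      have h2 : 0 ≤ exp y - 1 := by linarith [Real.add_one_le_exp y]
      nlinarith
    · have h1 := key (-y) (by linarith)
      have h2 : exp (-y) * exp y = 1 := by rw [← Real.exp_add]; simp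
      have h3 : 2 * (1 - exp y) ≤ -y * (1 + exp y) := by
        have := mul_le_mul_of_nonneg_right h1 (Real.exp_pos y).le
        nlinarith
      have h4 : exp y ≤ 1 := by simpa using h
      nlinarith
  nlinarith [mul_nonneg (sq_nonneg y) (sq_nonneg (exp y - 1))]

lemma rpow_bd (u h : ℝ) (hu : 0 < u) (h0 : 0 < h) (h1 : h < 1/5) :
    (u^h - 1)^2 * u^h ≤ h^2 * (log u)^2 * ((1 - 2*h) + 2*h*u) := by
  have e1 : u^h = exp (h * log u) := by rw [Real.rpow_def_of_pos hu]; ring_nf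
  have e3 : u^(3*h) = (u^h)^3 := by rw [← Real.rpow_natCast, ← Real.rpow_mul hu.le]; ring_nf
  have b1 := rpow_one_add_le_one_add_mul_self (s := u - 1) (by linarith) h0.le (by linarith)
  have b3 := rpow_one_add_le_one_add_mul_self (s := u - 1) (p := 3*h) (by linarith) (by linarith) (by linarith)
  have hb := exp_bd (h * log u)
  rw [← e1] at hb
  rw [add_sub_cancel] at b1 b3
  rw [e3] at b3
  have hp : 0 < u^h := Real.rpow_pos_of_pos hu h
  calc _ ≤ ((h * log u)^2 * ((u^h)^2+1)/2) * u^h := by gcongr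
    _ = (h * log u)^2 * (((u^h)^3 + u^h)/2) := by ring
    _ ≤ (h * log u)^2 * (((1+3*h*(u-1)) + (1+h*(u-1)))/2) := by gcongr
    _ = _ := by ring

lemma log_bd (u s : ℝ) (hu : 0 < u) : s^2 * (log u)^2 ≤ u^s + u^(-s) - 2 := by
  rw [Real.rpow_def_of_pos hu, Real.rpow_def_of_pos hu]
  have key : ∀ z : ℝ, 0 ≤ z → 4*z^2 ≤ exp (2*z) + exp (-(2*z)) - 2 := by
    intro z hz
    have := Real.self_le_sinh_iff.2 hz
    rw [Real.sinh_eq] at this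
    have a : exp (2*z) = exp z ^2 := by rw [← Real.exp_nat_mul]; simp
    have b : exp (-(2*z)) = exp (-z) ^2 := by rw [← Real.exp_nat_mul]; simp
    have h2 : exp (-z) * exp z = 1 := by rw [← Real.exp_add]; simp
    rw [a, b]
    nlinarith
  rcases le_total 0 (s * log u) with h | h
  · have := key (s*log u/2) (by linarith)
    ring_nf at this ⊢; linarith
  · have := key (-(s*log u)/2) (by linarith)
    ring_nf at this ⊢; linarith

lemma gam_bd : Real.eulerMascheroniConstant < 0.5958 := by
  have := Real.eulerMascheroniConstant_lt_eulerMascheroniSeq' 32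
  have h : Real.eulerMascheroniSeq' 32 = (harmonic 32 : ℝ) - 5 * log 2 := by
    rw [Real.eulerMascheroniSeq']
    simp
    rw [show (32:ℝ) = 2^5 by norm_num, Real.log_pow]; norm_num
  have h3 : harmonic 32 < 4.0585 := by
    norm_num [harmonic, Finset.sum_range_succ]
  have h4 : (harmonic 32 : ℝ) < 4.0585 := by
    have := (Rat.cast_lt (K := ℝ)).2 h3
    norm_num at this ⊢
  have := Real.log_two_gt_d9
  linarith

lemma const_bd : π^2/6 + Real.eulerMascheroniConstant^2 ≤ 2 := by
  have := gam_bd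
  have h := Real.one_half_lt_eulerMascheroniConstant
  have := Real.pi_lt_d4
  have := Real.pi_pos
  norm_num at *
  nlinarith

lemma gam_int (s : ℝ) (hs : -1 < s) : IntegrableOn (fun u : ℝ => exp (-u) * u^s) (Set.Ioi 0) ∧
    ∫ u in Set.Ioi (0:ℝ), exp (-u) * u^s = Gamma (1 + s) := by
  have a := Real.GammaIntegral_convergent (s := 1 + s) (by linarith)
  have b := Real.Gamma_eq_integral (s := 1 + s) (by linarith)
  simp only [add_sub_cancel_left] at a b
  exact ⟨a, b.symm⟩

lemma cosh_int (s : ℝ) (hs : -1 < s) (hs' : s < 1) :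
    IntegrableOn (fun u : ℝ => exp (-u) * (u^s + u^(-s) - 2)) (Set.Ioi 0) ∧
    ∫ u in Set.Ioi (0:ℝ), exp (-u) * (u^s + u^(-s) - 2) = Gamma (1 + s) + Gamma (1 - s) - 2 := by
  obtain ⟨a, a'⟩ := gam_int s hs
  obtain ⟨b, b'⟩ := gam_int (-s) (by linarith)
  obtain ⟨c, c'⟩ := gam_int 0 (by norm_num)
  have e : (fun u : ℝ => exp (-u) * (u^s + u^(-s) - 2)) =
    fun u => (exp (-u) * u^s + exp (-u) * u^(-s)) - 2 * (exp (-u) * u^(0:ℝ)) := by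
    funext u; rw [Real.rpow_zero]; ring
  rw [e]
  refine ⟨(a.add b).sub (c.const_mul 2), ?_⟩
  rw [integral_sub (by exact a.add b) (c.const_mul 2), integral_add a b, integral_const_mul, a', b', c']
  simp [sub_eq_add_neg]

lemma logsq_int : IntegrableOn (fun u : ℝ => exp (-u) * (log u)^2) (Set.Ioi 0) := by
  have h := (cosh_int (1/2) (by norm_num) (by norm_num)).1.const_mul 4
  refine Integrable.mono' h (by fun_prop) ?_
  filter_upwards [ae_restrict_mem measurableSet_Ioi] with u hu
  have := log_bd u (1/2) hu
  rw [Real.norm_of_nonneg (by positivity)]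
  have := mul_le_mul_of_nonneg_left this (exp_pos (-u)).le
  linarith

lemma A_le (s : ℝ) (h0 : 0 < s) (h1 : s < 1) :
    s^2 * ∫ u in Set.Ioi (0:ℝ), exp (-u) * (log u)^2 ≤ Gamma (1 + s) + Gamma (1 - s) - 2 := by
  obtain ⟨a, b⟩ := cosh_int s (by linarith) h1
  rw [← b, ← integral_const_mul]
  refine setIntegral_mono_on (logsq_int.const_mul _) a measurableSet_Ioi ?_
  intro u hu
  have := mul_le_mul_of_nonneg_left (log_bd u s hu) (exp_pos (-u)).le
  linarith

lemma A_le' (s : ℝ) (h0 : 0 < s) (h1 : s < 1/2) :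
    ∫ u in Set.Ioi (0:ℝ), exp (-u) * (log u)^2 ≤
      (π^2/6)/(1 - π^2/6*s^2) + (s⁻¹ * (Gamma (1+s) - Gamma 1)) * ((-s)⁻¹ * (Gamma (1 + -s) - Gamma 1)) := by
  have a := A_le s h0 (by linarith)
  have hpi : π^2 < 10 := by nlinarith [Real.pi_lt_d2, Real.pi_pos]
  have hd : 0 < 1 - π^2/6*s^2 := by nlinarith
  have hr : Gamma (1+s) * Gamma (1-s) = s * (π / sin (π * s)) := by
    rw [← Real.Gamma_mul_Gamma_one_sub, add_comm, Real.Gamma_add_one h0.ne']; ring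
  have hps : 0 < π * s := by positivity
  have hs := Real.sin_ge_sub_cube hps.le
  have hs2 : π * s * (1 - π^2/6*s^2) ≤ sin (π*s) := by linarith
  have hr2 : Gamma (1+s) * Gamma (1-s) ≤ 1/(1 - π^2/6*s^2) := by
    rw [hr, ← mul_div_assoc, div_le_div_iff₀ (lt_of_lt_of_le (by positivity) hs2) hd]
    linarith
  have hr3 : 1/(1 - π^2/6*s^2) = 1 + s^2 * ((π^2/6)/(1 - π^2/6*s^2)) := by
    have hd' := hd.ne'
    rw [← mul_div_assoc, div_eq_iff hd', add_mul, div_mul_cancel₀ _ hd']; ring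
  have e : (s⁻¹ * (Gamma (1+s) - Gamma 1)) * ((-s)⁻¹ * (Gamma (1 + -s) - Gamma 1)) = 
     - ((Gamma (1+s) - 1) * (Gamma (1 - s) - 1)) / s^2 := by
    rw [Real.Gamma_one, ← sub_eq_add_neg]; field_simp
  rw [e]
  have hs0 : 0 < s^2 := by positivity
  refine le_of_mul_le_mul_left (a.trans ?_) hs0
  rw [mul_add, mul_div_cancel₀ _ hs0.ne']
  linarith

lemma A_le_two : ∫ u in Set.Ioi (0:ℝ), exp (-u) * (log u)^2 ≤ 2 := by
  refine le_trans ?_ const_bd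
  have hd := hasDerivAt_iff_tendsto_slope_zero.1 Real.hasDerivAt_Gamma_one
  have hd1 := hd.mono_left (nhdsWithin_mono (0:ℝ) (show Set.Ioi (0:ℝ) ⊆ {0}ᶜ from fun x hx => ne_of_gt hx))
  have hneg : Filter.Tendsto (fun s : ℝ => -s) (nhdsWithin 0 (Set.Ioi 0)) (nhdsWithin 0 {0}ᶜ) := by
    refine tendsto_nhdsWithin_iff.2 ⟨?_, ?_⟩
    · have : Filter.Tendsto (fun s : ℝ => -s) (nhds 0) (nhds (-0)) := (continuous_neg).tendsto 0
      rw [neg_zero] at this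
      exact this.mono_left nhdsWithin_le_nhds
    · filter_upwards [self_mem_nhdsWithin] with s hs
      simpa using (ne_of_gt hs)
  have hd2 := hd.comp hneg
  have hc : Filter.Tendsto (fun s : ℝ => (π^2/6)/(1 - π^2/6*s^2)) (nhdsWithin 0 (Set.Ioi 0)) (nhds (π^2/6)) := by
    have : ContinuousAt (fun s : ℝ => (π^2/6)/(1 - π^2/6*s^2)) 0 := by
      apply ContinuousAt.div <;> first | fun_prop | simp
    have := this.tendsto
    simp only [ne_eq, OfNat.ofNat_ne_zero, not_false_eq_true, zero_pow, mul_zero, sub_zero, div_one] at this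
    exact this.mono_left nhdsWithin_le_nhds
  have ht := hc.add (hd1.mul hd2)
  rw [show π^2/6 + -eulerMascheroniConstant * -eulerMascheroniConstant = π^2/6 + eulerMascheroniConstant^2 by ring] at ht
  refine ge_of_tendsto ht ?_
  filter_upwards [Ioo_mem_nhdsGT (show (0:ℝ) < 1/2 by norm_num)] with s hs
  exact A_le' s hs.1 hs.2

lemma B_int : IntegrableOn (fun u : ℝ => exp (-u) * (u-1)^2) (Set.Ioi 0) ∧
    ∫ u in Set.Ioi (0:ℝ), exp (-u) * (u-1)^2 = 1 := by
  obtain ⟨a, a'⟩ := gam_int 2 (by norm_num)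
  obtain ⟨b, b'⟩ := gam_int 1 (by norm_num)
  obtain ⟨c, c'⟩ := gam_int 0 (by norm_num)
  have e : (fun u : ℝ => exp (-u) * (u-1)^2) =
    fun u => (exp (-u) * u^(2:ℝ) - 2 * (exp (-u) * u^(1:ℝ))) + exp (-u) * u^(0:ℝ) := by
    funext u; rw [Real.rpow_zero, Real.rpow_one, Real.rpow_two]; ring
  rw [e]
  refine ⟨(a.sub (b.const_mul 2)).add c, ?_⟩
  rw [integral_add (by exact a.sub (b.const_mul 2)) c, integral_sub a (b.const_mul 2), integral_const_mul, a', b', c']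
  have h3 : Gamma (1+2) = 2 := by
    have := Real.Gamma_nat_eq_factorial 2
    norm_num at this ⊢
  have h2 : Gamma (1+1) = 1 := by
    norm_num
  rw [h3, h2]; simp

lemma main_bd (h : ℝ) (h0 : 0 < h) (h1 : h < 1/5) :
    ∫ u in Set.Ioi (0:ℝ), (u^h-1)^2 * u^h * exp (-u) ≤ 2 * h^2 := by
  have hA := logsq_int.const_mul (h^2*(1-2*h))
  have hB := B_int.1.const_mul (h^2*(2*h))
  have : ∫ u in Set.Ioi (0:ℝ), (u^h-1)^2 * u^h * exp (-u) ≤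
     ∫ u in Set.Ioi (0:ℝ), (h^2*(1-2*h) * (exp (-u) * (log u)^2) + h^2*(2*h) * (exp (-u) * (u-1)^2)) := by
    refine integral_mono_of_nonneg ?_ (hA.add hB) ?_
    · filter_upwards [ae_restrict_mem measurableSet_Ioi] with u hu
      have : 0 < u := hu
      simp only [Pi.zero_apply]
      positivity
    · filter_upwards [ae_restrict_mem measurableSet_Ioi] with u hu
      have hu : 0 < u := hu
      have l1 := rpow_bd u h hu h0 h1
      have l2 := log_bd u 1 hu
      rw [Real.rpow_one, Real.rpow_neg_one] at l2
      have l3 : u * (log u)^2 ≤ (u-1)^2 := by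
        have := mul_le_mul_of_nonneg_left l2 hu.le
        have e : u * u⁻¹ = 1 := mul_inv_cancel₀ hu.ne'
        nlinarith
      have l4 : (u^h-1)^2 * u^h ≤ h^2*(1-2*h) * (log u)^2 + h^2*(2*h) * (u-1)^2 := by
        have := mul_le_mul_of_nonneg_left l3 (show 0 ≤ h^2*(2*h) by positivity)
        linarith
      have := mul_le_mul_of_nonneg_right l4 (exp_pos (-u)).le
      linarith
  refine this.trans ?_
  rw [integral_add hA hB, integral_const_mul, integral_const_mul, B_int.2]
  have := mul_le_mul_of_nonneg_left A_le_two (show 0 ≤ h^2*(1-2*h) by apply mul_nonneg; positivity; linarith)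
  have : 0 < h^3 := by positivity
  nlinarith

theorem second_moment_R_bound (p : ℝ) (hp : 5 < p) :
    ∫ x in Set.Ioi (0:ℝ),
        |x - 1| ^ 2 * ((Real.Gamma (1 + 1 / p))⁻¹ * p * x ^ p * Real.exp (-(x ^ p)))
      ≤ 2 / (Real.Gamma (1 + 1 / p) * p ^ 2) := by
  have hp0 : 0 < p := by linarith
  have hG : 0 < Real.Gamma (1 + 1 / p) := Real.Gamma_pos_of_pos (by positivity)
  have hm := main_bd (1/p) (by positivity) (by
    rw [div_lt_div_iff₀ hp0 (by norm_num)]; linarith)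
  rw [← integral_comp_rpow_Ioi_of_pos hp0] at hm
  have e : ∫ x in Set.Ioi (0:ℝ),
        |x - 1| ^ 2 * ((Real.Gamma (1 + 1 / p))⁻¹ * p * x ^ p * Real.exp (-(x ^ p)))
      = (Real.Gamma (1 + 1 / p))⁻¹ * ∫ x in Set.Ioi (0:ℝ), (p * x ^ (p - 1)) •
        (((x^p)^(1/p)-1)^2 * (x^p)^(1/p) * exp (-(x^p))) := by
    rw [← integral_const_mul]
    refine setIntegral_congr_fun measurableSet_Ioi ?_
    intro x hx
    have hx : 0 < x := hx
    have e1 : (x^p)^(1/p) = x := by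
      rw [← Real.rpow_mul hx.le, mul_one_div_cancel hp0.ne', Real.rpow_one]
    have e2 : x^p = x^(p-1) * x := by
      rw [← Real.rpow_add_one hx.ne']; simp
    simp only [e1, sq_abs, smul_eq_mul]
    rw [show ∀ a b c d : ℝ, a * (b * p * c * d) = b * p * c * d * a from fun a b c d => by ring]
    generalize exp (-(x^p)) = E
    rw [e2]; ring
  rw [e]
  calc _ ≤ (Real.Gamma (1 + 1 / p))⁻¹ * (2 * (1/p)^2) := by gcongr
    _ = _ := by field_simp
end
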